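/- arXiv:2211.00950 — 2 statements merged into one kernel-verified Lean document; each statement's English description precedes it below -/
import Mathlib

section
/- Let k ∈ {1,2,3,4} and let λ = Σ_{i=1}^{4} a_i ϖ_i where the a_i are nonnegative integers and a_k = 0. Then T_{λ,k} ∩ ℤ = {1, 2, …, M_{λ,k}} if and only if for every integer t at least one of the following holds: (1) (λ+ρ−tϖ_k, α) > 0 for every α ∈ Φ⁺; (2) the number of α ∈ Φ⁺ with (λ+ρ−tϖ_k, α) < 0 equals the cardinality of Φ⁺_k and (λ+ρ−tϖ_k, α) ≠ 0 for every α ∈ Φ⁺; (3) there exists α ∈ Φ⁺ with (λ+ρ−tϖ_k, α) = 0. -/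
noncomputable section

/-- The ambient space ℝ^4. -/
abbrev V : Type := Fin 4 → ℝ

/-- The standard inner product on ℝ^4. -/
def ip (x y : V) : ℝ := ∑ i, x i * y i

/-- The standard basis vectors ε_1, …, ε_4 (indexed from 0). -/
def eps (i : Fin 4) : V := fun j => if j = i then 1 else 0

/-- The F4 root system: ±ε_i, ±ε_i±ε_j (i<j), and ½(±ε_1±ε_2±ε_3±ε_4). -/
def PhiF4 : Set V :=
  {α | (∃ i : Fin 4, α = eps i ∨ α = -eps i) ∨
       (∃ i j : Fin 4, i < j ∧ ∃ s t : ℝ, (s = 1 ∨ s = -1) ∧ (t = 1 ∨ t = -1) ∧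
          α = s • eps i + t • eps j) ∨
       (∃ s : Fin 4 → ℝ, (∀ i, s i = 1 ∨ s i = -1) ∧
          α = (1/2 : ℝ) • ∑ i, s i • eps i)}

/-- Simple roots α_1, …, α_4 of F4 (indexed from 0). -/
def sroot : Fin 4 → V :=
  ![eps 1 - eps 2,
    eps 2 - eps 3,
    eps 3,
    (1/2 : ℝ) • (eps 0 - eps 1 - eps 2 - eps 3)]

/-- Positive roots of F4: elements of Φ_{F4} that are nonnegative
    combinations of the simple roots. -/
def PosF : Set V :=
  {α | α ∈ PhiF4 ∧ ∃ c : Fin 4 → ℝ, (∀ i, 0 ≤ c i) ∧ α = ∑ i, c i • sroot i}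

/-- Fundamental weights ϖ_1, …, ϖ_4 of F4 (indexed from 0). -/
def wF : Fin 4 → V :=
  ![eps 0 + eps 1,
    (2 : ℝ) • eps 0 + eps 1 + eps 2,
    (1/2 : ℝ) • ((3 : ℝ) • eps 0 + eps 1 + eps 2 + eps 3),
    eps 0]

/-- ρ = ϖ_1 + ϖ_2 + ϖ_3 + ϖ_4. -/
def rhoF : V := ∑ i, wF i

/-- Φ⁺_k = {α ∈ Φ⁺ : (ϖ_k, α) ≠ 0}. -/
def PhiKF (k : Fin 4) : Set V := {α ∈ PosF | ip (wF k) α ≠ 0}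

/-- λ = ∑ a_i ϖ_i. -/
def lamF (a : Fin 4 → ℕ) : V := ∑ i, (a i : ℝ) • wF i

/-- T_{λ,k} = {(λ+ρ, α)/c_{α,k} : α ∈ Φ⁺_k}. -/
def TF (a : Fin 4 → ℕ) (k : Fin 4) : Set ℝ :=
  {r | ∃ α ∈ PhiKF k, r = ip (lamF a + rhoF) α / ip (wF k) α}

/-- M_{λ,k} = max T_{λ,k} (the set is finite and nonempty, so max = sSup). -/
def MF (a : Fin 4 → ℕ) (k : Fin 4) : ℝ := sSup (TF a k)

/-- The condition T_{λ,k} ∩ ℤ = {1, 2, …, M_{λ,k}}. -/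
def ACMF (a : Fin 4 → ℕ) (k : Fin 4) : Prop :=
  {n : ℤ | (n : ℝ) ∈ TF a k} = {n : ℤ | 1 ≤ n ∧ (n : ℝ) ≤ MF a k}

lemma ip_sub_smul_left (x y z : V) (t : ℝ) : ip (x - t • y) z = ip x z - t * ip y z := by
  simp [ip, sub_mul, Finset.sum_sub_distrib, Finset.mul_sum, mul_assoc]

lemma ip_sum_smul_right {ι : Type*} (s : Finset ι) (x : V) (c : ι → ℝ) (v : ι → V) :
    ip x (∑ i ∈ s, c i • v i) = ∑ i ∈ s, c i * ip x (v i) := by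
  simp only [ip, Finset.sum_apply, Pi.smul_apply, smul_eq_mul, Finset.mul_sum]
  rw [Finset.sum_comm]
  exact Finset.sum_congr rfl fun _ _ => Finset.sum_congr rfl fun _ _ => by ring

lemma ip_wF_sroot_self_pos (k : Fin 4) : 0 < ip (wF k) (sroot k) := by
  fin_cases k <;> simp [ip, wF, sroot, eps, Fin.sum_univ_four]

lemma ip_wF_sroot_of_ne {i j : Fin 4} (h : i ≠ j) : ip (wF i) (sroot j) = 0 := by
  fin_cases i <;> fin_cases j <;>
    first
    | exact absurd rfl h
    | (simp [ip, wF, sroot, eps, Fin.sum_univ_four] <;> norm_num)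

lemma ip_wF_sroot_nonneg (i j : Fin 4) : 0 ≤ ip (wF i) (sroot j) := by
  rcases eq_or_ne i j with rfl | h
  · exact (ip_wF_sroot_self_pos i).le
  · exact (ip_wF_sroot_of_ne h).ge

/-- Pairing `λ + ρ` with a simple root picks out one coefficient. -/
lemma ip_lamF_add_rhoF_sroot (a : Fin 4 → ℕ) (j : Fin 4) :
    ip (lamF a + rhoF) (sroot j) = (a j + 1) * ip (wF j) (sroot j) := by
  have h : ip (lamF a + rhoF) (sroot j) = ∑ i, ((a i : ℝ) + 1) * ip (wF i) (sroot j) := by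
    simp only [lamF, rhoF, ip, Pi.add_apply, Pi.smul_apply, smul_eq_mul,
      Fin.sum_univ_four]
    ring
  rw [h, Finset.sum_eq_single j (fun i _ hij => by rw [ip_wF_sroot_of_ne hij, mul_zero])
    (by simp)]

lemma apply_mem_of_mem_PhiF4 {α : V} (h : α ∈ PhiF4) (j : Fin 4) :
    α j ∈ ({0, 1, -1, 1 / 2, -1 / 2} : Set ℝ) := by
  rcases h with ⟨i, rfl | rfl⟩ | ⟨i, l, hil, s, t, hs, ht, rfl⟩ | ⟨s, hs, rfl⟩
  · by_cases hj : j = i <;> simp [eps, hj]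
  · by_cases hj : j = i <;> simp [eps, hj]
  · rcases eq_or_ne j i with rfl | hj
    · rcases hs with rfl | rfl <;> simp [eps, hil.ne]
    · rcases ht with rfl | rfl <;> by_cases hl : j = l <;> simp [eps, hj, hl, hil.ne']
  · have : ((1 / 2 : ℝ) • ∑ i, s i • eps i) j = s j / 2 := by
      simp [eps]; ring
    rw [this]
    rcases hs j with h | h <;> simp [h]

lemma ne_zero_of_mem_PhiF4 {α : V} (h : α ∈ PhiF4) : α ≠ 0 := by
  rcases h with ⟨i, rfl | rfl⟩ | ⟨i, l, hil, s, t, hs, ht, rfl⟩ | ⟨s, hs, rfl⟩ <;> intro h0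
  · simpa [eps] using congrFun h0 i
  · simpa [eps] using congrFun h0 i
  · have := congrFun h0 i
    rcases hs with rfl | rfl <;> simp [eps, hil.ne] at this
  · have := congrFun h0 0
    rcases hs 0 with h | h <;> simp [eps, h] at this

lemma PosF_finite : PosF.Finite := by
  have hfin : (Set.univ.pi fun _ : Fin 4 => ({0, 1, -1, 1 / 2, -1 / 2} : Set ℝ)).Finite :=
    Set.Finite.pi fun _ => by simp
  exact hfin.subset fun α hα j _ => apply_mem_of_mem_PhiF4 hα.1 j

lemma sroot_mem_PhiF4 (k : Fin 4) : sroot k ∈ PhiF4 := by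
  fin_cases k
  · exact Or.inr (Or.inl ⟨1, 2, by decide, 1, -1, by simp, by simp, by simp [sroot, sub_eq_add_neg]⟩)
  · exact Or.inr (Or.inl ⟨2, 3, by decide, 1, -1, by simp, by simp, by simp [sroot, sub_eq_add_neg]⟩)
  · exact Or.inl ⟨3, by simp [sroot]⟩
  · refine Or.inr (Or.inr ⟨![1, -1, -1, -1], fun i => by fin_cases i <;> simp, ?_⟩)
    simp [sroot, Fin.sum_univ_four, sub_eq_add_neg]

lemma sroot_mem_PosF (k : Fin 4) : sroot k ∈ PosF :=
  ⟨sroot_mem_PhiF4 k, Pi.single k 1, fun i => by by_cases h : i = k <;> simp [h],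
    by simp [Pi.single_apply]⟩

lemma ip_wF_nonneg (k : Fin 4) {α : V} (h : α ∈ PosF) : 0 ≤ ip (wF k) α := by
  obtain ⟨-, c, hc, rfl⟩ := h
  rw [ip_sum_smul_right]
  exact Finset.sum_nonneg fun i _ => mul_nonneg (hc i) (ip_wF_sroot_nonneg k i)

lemma ip_lamF_add_rhoF_pos (a : Fin 4 → ℕ) {α : V} (h : α ∈ PosF) :
    0 < ip (lamF a + rhoF) α := by
  obtain ⟨hα, c, hc, rfl⟩ := h
  have hpos (i : Fin 4) : 0 < ip (lamF a + rhoF) (sroot i) := by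
    rw [ip_lamF_add_rhoF_sroot]
    exact mul_pos (by positivity) (ip_wF_sroot_self_pos i)
  obtain ⟨i, hi⟩ : ∃ i, c i ≠ 0 := by
    by_contra! h0
    exact ne_zero_of_mem_PhiF4 hα (by simp [h0])
  rw [ip_sum_smul_right]
  exact Finset.sum_pos' (fun j _ => mul_nonneg (hc j) (hpos j).le)
    ⟨i, Finset.mem_univ i, mul_pos ((hc i).lt_of_ne' hi) (hpos i)⟩

lemma ip_wF_pos {k : Fin 4} {α : V} (h : α ∈ PhiKF k) : 0 < ip (wF k) α :=
  (ip_wF_nonneg k h.1).lt_of_ne' h.2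

lemma TF_eq_image (a : Fin 4 → ℕ) (k : Fin 4) :
    TF a k = (fun α => ip (lamF a + rhoF) α / ip (wF k) α) '' PhiKF k := by
  ext r
  simp [TF, eq_comm]

lemma TF_finite (a : Fin 4 → ℕ) (k : Fin 4) : (TF a k).Finite := by
  rw [TF_eq_image]
  exact (PosF_finite.subset fun _ h => h.1).image _

lemma one_mem_TF {a : Fin 4 → ℕ} {k : Fin 4} (hk : a k = 0) : (1 : ℝ) ∈ TF a k := by
  have h := (ip_wF_sroot_self_pos k).ne'
  refine ⟨sroot k, ⟨sroot_mem_PosF k, h⟩, ?_⟩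
  rw [ip_lamF_add_rhoF_sroot, hk]
  simp [h]

lemma le_MF {a : Fin 4 → ℕ} {k : Fin 4} {r : ℝ} (h : r ∈ TF a k) : r ≤ MF a k :=
  le_csSup (TF_finite a k).bddAbove h

lemma MF_mem_TF {a : Fin 4 → ℕ} {k : Fin 4} (hk : a k = 0) : MF a k ∈ TF a k :=
  Set.Nonempty.csSup_mem ⟨1, one_mem_TF hk⟩ (TF_finite a k)

lemma pos_of_mem_TF {a : Fin 4 → ℕ} {k : Fin 4} {r : ℝ} (h : r ∈ TF a k) : 0 < r := by
  obtain ⟨α, hα, rfl⟩ := h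
  exact div_pos (ip_lamF_add_rhoF_pos a hα.1) (ip_wF_pos hα)

/-- The integer points of `T` are the `t` for which `λ + ρ - tϖ_k` is singular. -/
lemma mem_TF_iff (a : Fin 4 → ℕ) (k : Fin 4) (t : ℝ) :
    t ∈ TF a k ↔ ∃ α ∈ PosF, ip (lamF a + rhoF - t • wF k) α = 0 := by
  simp only [ip_sub_smul_left, sub_eq_zero]
  constructor
  · rintro ⟨α, hα, rfl⟩
    exact ⟨α, hα.1, (div_mul_cancel₀ _ hα.2).symm⟩
  · rintro ⟨α, hα, h⟩
    have hne : ip (wF k) α ≠ 0 := fun h0 =>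
      (ip_lamF_add_rhoF_pos a hα).ne' (by rw [h, h0, mul_zero])
    exact ⟨α, ⟨hα, hne⟩, by rw [h, mul_div_cancel_right₀ _ hne]⟩

lemma mem_PhiKF_of_ip_neg {a : Fin 4 → ℕ} {k : Fin 4} {t : ℝ} {α : V} (hα : α ∈ PosF)
    (h : ip (lamF a + rhoF - t • wF k) α < 0) : α ∈ PhiKF k := by
  refine ⟨hα, fun h0 => ?_⟩
  rw [ip_sub_smul_left, h0, mul_zero, sub_zero] at h
  exact h.not_gt (ip_lamF_add_rhoF_pos a hα)

/-- Condition (2) amounts to `t` exceeding the maximum of `T`. -/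
lemma ncard_neg_eq_iff {a : Fin 4 → ℕ} {k : Fin 4} (hk : a k = 0) (t : ℝ) :
    {α ∈ PosF | ip (lamF a + rhoF - t • wF k) α < 0}.ncard = (PhiKF k).ncard ↔ MF a k < t := by
  have hsub : {α ∈ PosF | ip (lamF a + rhoF - t • wF k) α < 0} ⊆ PhiKF k :=
    fun α hα => mem_PhiKF_of_ip_neg hα.1 hα.2
  constructor
  · intro h
    have heq := Set.eq_of_subset_of_ncard_le hsub h.ge (PosF_finite.subset fun _ h => h.1)
    obtain ⟨α, hα, hM⟩ := MF_mem_TF hk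
    have hneg := (heq.ge hα).2
    rw [ip_sub_smul_left, sub_neg] at hneg
    rwa [hM, div_lt_iff₀ (ip_wF_pos hα)]
  · intro h
    congr 1
    refine hsub.antisymm fun α hα => ⟨hα.1, ?_⟩
    rw [ip_sub_smul_left, sub_neg, ← div_lt_iff₀ (ip_wF_pos hα)]
    exact (le_MF ⟨α, hα, rfl⟩).trans_lt h

lemma forall_ip_pos_of_nonpos (a : Fin 4 → ℕ) (k : Fin 4) {t : ℝ} (ht : t ≤ 0) :
    ∀ α ∈ PosF, 0 < ip (lamF a + rhoF - t • wF k) α := by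
  intro α hα
  rw [ip_sub_smul_left]
  linarith [ip_lamF_add_rhoF_pos a hα, mul_nonpos_of_nonpos_of_nonneg ht (ip_wF_nonneg k hα)]

lemma lt_one_of_forall_ip_pos {a : Fin 4 → ℕ} {k : Fin 4} (hk : a k = 0) {t : ℝ}
    (h : ∀ α ∈ PosF, 0 < ip (lamF a + rhoF - t • wF k) α) : t < 1 := by
  have := h _ (sroot_mem_PosF k)
  rw [ip_sub_smul_left, ip_lamF_add_rhoF_sroot, hk, Nat.cast_zero, zero_add, ← sub_mul] at this
  exact sub_pos.1 (pos_of_mul_pos_left this (ip_wF_sroot_self_pos k).le)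

/-- the Borel–Weil–Bott criterion for `T_{λ,k} ∩ ℤ = [1, M_{λ,k}]`
    on F4/P_{α_k}. -/
theorem stmt3 (k : Fin 4) (a : Fin 4 → ℕ) (hk : a k = 0) :
    ACMF a k ↔
      ∀ t : ℤ,
        (∀ α ∈ PosF, 0 < ip (lamF a + rhoF - (t : ℝ) • wF k) α) ∨
        ({α ∈ PosF | ip (lamF a + rhoF - (t : ℝ) • wF k) α < 0}.ncard
            = (PhiKF k).ncard ∧
          ∀ α ∈ PosF, ip (lamF a + rhoF - (t : ℝ) • wF k) α ≠ 0) ∨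
        (∃ α ∈ PosF, ip (lamF a + rhoF - (t : ℝ) • wF k) α = 0) := by
  simp only [ncard_neg_eq_iff hk, ← mem_TF_iff]
  constructor
  · intro h t
    rcases le_or_gt t 0 with h0 | h0
    · exact Or.inl (forall_ip_pos_of_nonpos a k (by exact_mod_cast h0))
    rcases le_or_gt (t : ℝ) (MF a k) with hM | hM
    · exact Or.inr (Or.inr (h.ge ⟨h0, hM⟩))
    · exact Or.inr (Or.inl ⟨hM, fun α hα h0 =>
        (le_MF ((mem_TF_iff a k t).2 ⟨α, hα, h0⟩)).not_gt hM⟩)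
  · intro h
    ext n
    constructor
    · intro hn
      exact ⟨by exact_mod_cast pos_of_mem_TF hn, le_MF hn⟩
    · rintro ⟨h1, hM⟩
      rcases h n with hpos | ⟨hlt, -⟩ | hmem
      · have : n < 1 := by exact_mod_cast lt_one_of_forall_ip_pos hk hpos
        omega
      · exact absurd hlt hM.not_gt
      · exact hmem
end
end

section
/- Let λ = Σ_{i=1}^{4} a_i ϖ_i with all a_i nonnegative integers and a_1 = 0. Then T_{λ,1} ∩ ℤ = {1, 2, …, M_{λ,1}} if and only if (a_1,a_2,a_3,a_4) equals (0,0,0,i) with 0 ≤ i ≤ 4, or (0,0,1,j) with j ∈ {0,1,2,3,5}. (This is the combinatorial criterion, via the main theorem, for an initialized irreducible homogeneous vector bundle on F4/P_{α_1} with highest weight λ to be an ACM bundle.) -/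
noncomputable section

/-- A root is a nonnegative combination of the simple roots iff it pairs nonnegatively
with every fundamental weight. -/
theorem mem_PosF_iff (α : V) :
    α ∈ PosF ↔ α ∈ PhiF4 ∧ 0 ≤ α 0 ∧ 0 ≤ α 0 + α 1 ∧ 0 ≤ 2 * α 0 + α 1 + α 2 ∧
      0 ≤ 3 * α 0 + α 1 + α 2 + α 3 := by
  refine and_congr_right fun _ => ⟨?_, ?_⟩
  · rintro ⟨c, hc, rfl⟩
    have h0 := hc 0
    have h1 := hc 1
    have h2 := hc 2
    have h3 := hc 3
    simp only [Fin.sum_univ_four, sroot, Pi.add_apply, Pi.smul_apply, smul_eq_mul]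
    refine ⟨?_, ?_, ?_, ?_⟩ <;> simp [eps] <;> linarith
  · rintro ⟨h0, h1, h2, h3⟩
    refine ⟨![α 0 + α 1, 2 * α 0 + α 1 + α 2, 3 * α 0 + α 1 + α 2 + α 3, 2 * α 0], ?_, ?_⟩
    · intro i
      fin_cases i <;> simp <;> linarith
    · ext i
      fin_cases i <;> simp [Fin.sum_univ_four, sroot, eps] <;> ring

theorem ip_wF_zero (α : V) : ip (wF 0) α = α 0 + α 1 := by
  simp [ip, wF, eps, Fin.sum_univ_four]

theorem ip_lamF_add_rhoF (a : Fin 4 → ℕ) (α : V) :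
    ip (lamF a + rhoF) α =
      (a 0 + 1) * (α 0 + α 1) + (a 1 + 1) * (2 * α 0 + α 1 + α 2) +
      (a 2 + 1) / 2 * (3 * α 0 + α 1 + α 2 + α 3) + (a 3 + 1) * α 0 := by
  simp [ip, lamF, rhoF, wF, eps, Fin.sum_univ_four]
  ring

theorem unit_mem_PhiF4 (i : Fin 4) : eps i ∈ PhiF4 :=
  Or.inl ⟨i, Or.inl rfl⟩

theorem long_mem_PhiF4 {i j : Fin 4} (hij : i < j) {t : ℝ} (ht : t = 1 ∨ t = -1) :
    eps i + t • eps j ∈ PhiF4 :=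
  Or.inr (Or.inl ⟨i, j, hij, 1, t, Or.inl rfl, ht, by simp⟩)

theorem half_mem_PhiF4 {s t : ℝ} (hs : s = 1 ∨ s = -1) (ht : t = 1 ∨ t = -1) :
    ![1 / 2, 1 / 2, s / 2, t / 2] ∈ PhiF4 := by
  refine Or.inr (Or.inr ⟨![1, 1, s, t], ?_, ?_⟩)
  · intro i
    fin_cases i <;> simp [hs, ht]
  · ext i
    fin_cases i <;> simp [Fin.sum_univ_four, eps] <;> ring

/-- The roots of `Φ⁺_1`: those whose first two coordinates are `(1, 0)`, `(0, 1)`, `(1, 1)`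
or `(1/2, 1/2)`. -/
theorem mem_PhiKF_zero_iff (α : V) :
    α ∈ PhiKF 0 ↔
      (∃ i : Fin 4, (i = 0 ∨ i = 1) ∧ (α = eps i ∨
        ∃ j : Fin 4, (j = 2 ∨ j = 3) ∧ ∃ t : ℝ, (t = 1 ∨ t = -1) ∧ α = eps i + t • eps j)) ∨
      α = eps 0 + (1 : ℝ) • eps 1 ∨
      ∃ s t : ℝ, (s = 1 ∨ s = -1) ∧ (t = 1 ∨ t = -1) ∧ α = ![1 / 2, 1 / 2, s / 2, t / 2] := by
  simp only [PhiKF, Set.mem_ofPred_eq, mem_PosF_iff, ip_wF_zero]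
  constructor
  · rintro ⟨⟨hα, h0, h1, -, -⟩, hne⟩
    have hpos : 0 < α 0 + α 1 := lt_of_le_of_ne h1 hne.symm
    clear h1 hne
    obtain ⟨i, rfl | rfl⟩ | ⟨i, j, hij, s, t, hs, ht, rfl⟩ | ⟨s, hs, rfl⟩ := hα
    · refine Or.inl ⟨i, ?_, Or.inl rfl⟩
      by_contra! hi
      simp [eps, hi.1.symm, hi.2.symm] at hpos
    · have hnonneg (k : Fin 4) : 0 ≤ eps i k := by
        simp only [eps]
        split_ifs <;> norm_num
      have := hnonneg 0
      have := hnonneg 1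
      simp only [Pi.neg_apply] at hpos
      linarith
    · by_cases hj : j = 2 ∨ j = 3
      · have hj0 : 0 ≠ j := by omega
        have hj1 : 1 ≠ j := by omega
        have hi : i = 0 ∨ i = 1 := by
          by_contra! hi
          simp [eps, hi.1.symm, hi.2.symm, hj0, hj1] at hpos
        obtain rfl : s = 1 := by
          refine hs.resolve_right ?_
          rintro rfl
          obtain rfl | rfl := hi <;> simp [eps, hj0, hj1] at hpos <;> linarith
        exact Or.inl ⟨i, hi, Or.inr ⟨j, hj, t, ht, by simp⟩⟩
      · obtain ⟨rfl, rfl⟩ : i = 0 ∧ j = 1 := by omega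
        simp [eps] at hpos
        obtain rfl : s = 1 := hs.resolve_right fun hs => by obtain rfl | rfl := ht <;> linarith
        obtain rfl : t = 1 := ht.resolve_right fun ht => by linarith
        simp
    · refine Or.inr (Or.inr ⟨s 2, s 3, hs 2, hs 3, ?_⟩)
      simp [eps, Fin.sum_univ_four] at hpos
      have hs0 : s 0 = 1 := by
        refine (hs 0).resolve_right fun h => ?_
        obtain h' | h' := hs 1 <;> linarith
      have hs1 : s 1 = 1 := (hs 1).resolve_right fun h => by linarith
      ext i
      fin_cases i <;> simp [eps, Fin.sum_univ_four, hs0, hs1] <;> ring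
  · rintro (⟨i, hi, rfl | ⟨j, hj, t, ht, rfl⟩⟩ | rfl | ⟨s, t, hs, ht, rfl⟩)
    · refine ⟨⟨unit_mem_PhiF4 i, ?_⟩, ?_⟩ <;> obtain rfl | rfl := hi <;> simp [eps]
    · refine ⟨⟨long_mem_PhiF4 (by omega) ht, ?_⟩, ?_⟩ <;> obtain rfl | rfl := ht <;>
        obtain rfl | rfl := hi <;> obtain rfl | rfl := hj <;> simp [eps] <;> norm_num
    · refine ⟨⟨long_mem_PhiF4 (by decide) (Or.inl rfl), ?_⟩, ?_⟩ <;> simp [eps] <;> norm_num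
    · refine ⟨⟨half_mem_PhiF4 hs ht, ?_⟩, ?_⟩ <;> obtain rfl | rfl := hs <;>
        obtain rfl | rfl := ht <;> simp <;> norm_num

/-- The values `(λ+ρ, α)/c_{α,1}` over the fifteen roots of `Φ⁺_1`, when `a_1 = 0`. -/
theorem mem_TF_zero_iff {a : Fin 4 → ℕ} (h : a 0 = 0) {b c d : ℕ} (hb : a 1 + 1 = b)
    (hc : a 2 + 1 = c) (hd : a 3 + 1 = d) (r : ℝ) :
    r ∈ TF a 0 ↔
      r = 1 ∨ r = 1 + b ∨ r = 1 + b + c / 2 ∨ r = 1 + b + c ∨ r = 1 + 2 * b + c ∨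
      r = 1 + b + c / 2 + d / 2 ∨ r = 1 + b + c + d / 2 ∨
      r = 1 + 3 * b / 2 + c + d / 2 ∨ r = 1 + 2 * b + c + d / 2 ∨
      r = 1 + 2 * b + 3 * c / 2 + d / 2 ∨ r = 1 + b + c + d ∨ r = 1 + 2 * b + c + d ∨
      r = 1 + 2 * b + 3 * c / 2 + d ∨ r = 1 + 2 * b + 2 * c + d ∨
      r = 1 + 3 * b + 2 * c + d := by
  have hb' : (a 1 : ℝ) + 1 = b := by exact_mod_cast hb
  have hc' : (a 2 : ℝ) + 1 = c := by exact_mod_cast hc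
  have hd' : (a 3 : ℝ) + 1 = d := by exact_mod_cast hd
  simp only [TF, Set.mem_ofPred_eq, mem_PhiKF_zero_iff, ip_wF_zero, ip_lamF_add_rhoF, h, hb', hc',
    hd', or_and_right, and_or_left, exists_or, exists_and_left, exists_eq_left]
  simp [eps]
  grind

/-- The largest value is attained at the root `ε_1 + ε_3`. -/
theorem MF_zero_eq {a : Fin 4 → ℕ} (h : a 0 = 0) {b c d : ℕ} (hb : a 1 + 1 = b)
    (hc : a 2 + 1 = c) (hd : a 3 + 1 = d) : MF a 0 = 1 + 3 * b + 2 * c + d := by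
  refine IsGreatest.csSup_eq ⟨(mem_TF_zero_iff h hb hc hd _).2 (by simp), fun r hr => ?_⟩
  have hb0 : (0 : ℝ) ≤ b := b.cast_nonneg
  have hc0 : (0 : ℝ) ≤ c := c.cast_nonneg
  have hd0 : (0 : ℝ) ≤ d := d.cast_nonneg
  rw [mem_TF_zero_iff h hb hc hd] at hr
  rcases hr with h | h | h | h | h | h | h | h | h | h | h | h | h | h | h <;> linarith

theorem ACMF_zero_iff {a : Fin 4 → ℕ} (h : a 0 = 0) {b c d : ℕ} (hb : a 1 + 1 = b)
    (hc : a 2 + 1 = c) (hd : a 3 + 1 = d) :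
    ACMF a 0 ↔ ∀ n : ℤ,
      (n = 1 ∨ n = 1 + b ∨ 2 * n = 2 + 2 * b + c ∨ n = 1 + b + c ∨ n = 1 + 2 * b + c ∨
       2 * n = 2 + 2 * b + c + d ∨ 2 * n = 2 + 2 * b + 2 * c + d ∨
       2 * n = 2 + 3 * b + 2 * c + d ∨ 2 * n = 2 + 4 * b + 2 * c + d ∨
       2 * n = 2 + 4 * b + 3 * c + d ∨ n = 1 + b + c + d ∨ n = 1 + 2 * b + c + d ∨
       2 * n = 2 + 4 * b + 3 * c + 2 * d ∨ n = 1 + 2 * b + 2 * c + d ∨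
       n = 1 + 3 * b + 2 * c + d) ↔ 1 ≤ n ∧ n ≤ 1 + 3 * b + 2 * c + d := by
  simp only [ACMF, Set.ext_iff, Set.mem_ofPred_eq, mem_TF_zero_iff h hb hc hd,
    MF_zero_eq h hb hc hd]
  refine forall_congr' fun n => iff_congr ?_ (and_congr_right fun _ => by exact_mod_cast Iff.rfl)
  rify
  refine or_congr Iff.rfl <| or_congr Iff.rfl <| or_congr ?_ <| or_congr Iff.rfl <|
    or_congr Iff.rfl <| or_congr ?_ <| or_congr ?_ <| or_congr ?_ <| or_congr ?_ <|
    or_congr ?_ <| or_congr Iff.rfl <| or_congr Iff.rfl <| or_congr ?_ Iff.rfl <;>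
  constructor <;> intro <;> linarith

/-- the ACM criterion on F4/P_{α_1} (k = 1 is indexed here
    by 0). -/
theorem stmt17 (a : Fin 4 → ℕ) (h : a 0 = 0) :
    ACMF a 0 ↔
      ((∃ i : ℕ, i ≤ 4 ∧ a = ![0, 0, 0, i]) ∨
       (∃ j : ℕ, j ∈ ({0, 1, 2, 3, 5} : Finset ℕ) ∧ a = ![0, 0, 1, j])) := by
  rw [ACMF_zero_iff h rfl rfl rfl]
  have hvec (x y z : ℕ) : a = ![0, x, y, z] ↔ a 1 = x ∧ a 2 = y ∧ a 3 = z := by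
    simp [funext_iff, Fin.forall_fin_succ, h]
  simp only [hvec, Finset.mem_insert, Finset.mem_singleton]
  push_cast
  generalize a 1 = x
  generalize a 2 = y
  generalize a 3 = z
  constructor
  · intro H
    have H2 := H 2
    have H3 := H 3
    have H5 := H 5
    have H6 := H 6
    omega
  · rintro (⟨hz, rfl, rfl, -⟩ | ⟨hz, rfl, rfl, -⟩) n
    · interval_cases z <;> omega
    · rcases hz with rfl | rfl | rfl | rfl | rfl <;> omega
end
end
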